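/- With η(iy) = e^{−πy/12} ∏_{n=1}^{∞} (1 − e^{−2πny}) for y > 0, one has η(i) = Γ(1/4) / (2 π^{3/4}); equivalently, 1/η(i)² = 4 π^{3/2} / Γ(1/4)². -/

import Mathlib

open Real

/-- The Dedekind eta function on the positive imaginary axis:
`η(iy) = e^{−πy/12} ∏_{n≥1} (1 − e^{−2πny})`. -/
noncomputable def etaI (y : ℝ) : ℝ :=
  Real.exp (-π * y / 12) * ∏' n : ℕ, (1 - Real.exp (-2 * π * (n + 1) * y))

/-- The square lattice `ℤ + ℤ i`. -/
noncomputable def gaussianPeriods : PeriodPair where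
  ω₁ := 1
  ω₂ := Complex.I
  indep := by
    simpa [Complex.coe_basisOneI] using Complex.basisOneI.linearIndependent

namespace gaussianPeriods

open Real Complex PeriodPair Filter Topology

lemma mem_lattice_iff {z : ℂ} :
    z ∈ gaussianPeriods.lattice ↔ ∃ m n : ℤ, (m : ℂ) + n * I = z := by
  simp [PeriodPair.mem_lattice, gaussianPeriods]

/-- Multiplication by `i` on the square lattice. -/
noncomputable def mulI : gaussianPeriods.lattice ≃ gaussianPeriods.lattice where
  toFun l := ⟨I * l, by
    obtain ⟨m, n, h⟩ := mem_lattice_iff.1 l.2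
    refine mem_lattice_iff.2 ⟨-n, m, ?_⟩
    rw [← h]; push_cast; linear_combination (-(n : ℂ)) * I_sq⟩
  invFun l := ⟨-I * l, by
    obtain ⟨m, n, h⟩ := mem_lattice_iff.1 l.2
    refine mem_lattice_iff.2 ⟨n, -m, ?_⟩
    rw [← h]; push_cast; linear_combination (n : ℂ) * I_sq⟩
  left_inv l := by ext; simp [← mul_assoc]
  right_inv l := by ext; simp [← mul_assoc]

/-- Complex conjugation on the square lattice. -/
noncomputable def conjEquiv : gaussianPeriods.lattice ≃ gaussianPeriods.lattice :=
  have key (l : gaussianPeriods.lattice) :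
      (starRingEnd ℂ) (l : ℂ) ∈ gaussianPeriods.lattice := by
    obtain ⟨m, n, h⟩ := mem_lattice_iff.1 l.2
    exact mem_lattice_iff.2 ⟨m, -n, by rw [← h]; simp⟩
  { toFun l := ⟨_, key l⟩
    invFun l := ⟨_, key l⟩
    left_inv l := by ext; simp
    right_inv l := by ext; simp }

@[simp] lemma coe_mulI (l : gaussianPeriods.lattice) : (mulI l : ℂ) = I * l := rfl

@[simp] lemma coe_conjEquiv (l : gaussianPeriods.lattice) :
    (conjEquiv l : ℂ) = (starRingEnd ℂ) (l : ℂ) := rfl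

lemma G_six : gaussianPeriods.G 6 = 0 := by
  rw [← CharZero.eq_neg_self_iff]
  conv_lhs => rw [PeriodPair.G, ← mulI.tsum_eq]
  rw [PeriodPair.G, ← tsum_neg]
  refine tsum_congr fun l ↦ ?_
  rw [coe_mulI, mul_pow, show I ^ 6 = -1 by linear_combination (I ^ 4 - I ^ 2 + 1) * I_sq]
  simp

lemma conj_G (k : ℕ) : (starRingEnd ℂ) (gaussianPeriods.G k) = gaussianPeriods.G k := by
  rw [PeriodPair.G, conj_tsum]
  conv_rhs => rw [← conjEquiv.tsum_eq]
  exact tsum_congr fun l ↦ by simp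

lemma conj_weierstrassP (z : ℂ) :
    (starRingEnd ℂ) (gaussianPeriods.weierstrassP z) =
      gaussianPeriods.weierstrassP ((starRingEnd ℂ) z) := by
  rw [weierstrassP, weierstrassP, conj_tsum]
  conv_rhs => rw [← conjEquiv.tsum_eq]
  exact tsum_congr fun l ↦ by simp

lemma conj_derivWeierstrassP (z : ℂ) :
    (starRingEnd ℂ) (gaussianPeriods.derivWeierstrassP z) =
      gaussianPeriods.derivWeierstrassP ((starRingEnd ℂ) z) := by
  rw [derivWeierstrassP, derivWeierstrassP, map_neg, conj_tsum]
  conv_rhs => rw [← conjEquiv.tsum_eq]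
  simp [Complex.conj_ofNat]

lemma G_eq_riemannZeta_mul_E {k : ℕ} (hk : 3 ≤ k) :
    gaussianPeriods.G k =
      2 * riemannZeta k * ModularForm.E hk UpperHalfPlane.I := by
  have h1 : ModularForm.E hk UpperHalfPlane.I =
      (1 / 2 : ℂ) * eisensteinSeries (N := 1) 0 k UpperHalfPlane.I := rfl
  have h2 := tsum_eisSummand_eq_riemannZeta_mul_eisensteinSeries hk UpperHalfPlane.I
  rw [h1, show ∀ a b : ℂ, 2 * a * (1 / 2 * b) = a * b by intros; ring, ← h2, PeriodPair.G,
    ← gaussianPeriods.latticeEquivProd.symm.toEquiv.tsum_eq,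
    ← ((Equiv.prodComm ℤ ℤ).trans (finTwoArrowEquiv ℤ).symm).tsum_eq]
  refine tsum_congr fun x ↦ ?_
  have hx : ((gaussianPeriods.latticeEquivProd.symm.toEquiv x : gaussianPeriods.lattice) : ℂ) =
      x.1 + x.2 * I := by
    exact (gaussianPeriods.latticeEquiv_symm_apply x).trans (by simp [gaussianPeriods])
  rw [hx]
  simp [EisensteinSeries.eisSummand, add_comm]

lemma E₄_I : ModularForm.E₄ UpperHalfPlane.I = 45 / π ^ 4 * gaussianPeriods.G 4 := by
  have h := G_eq_riemannZeta_mul_E (k := 4) (by norm_num)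
  have hz : riemannZeta (4 : ℕ) = π ^ 4 / 90 := by exact_mod_cast riemannZeta_four
  have hpi : (π : ℂ) ≠ 0 := by simp
  rw [h, hz]
  field_simp
  ring

lemma E₆_I : ModularForm.E₆ UpperHalfPlane.I = 0 := by
  have h := G_eq_riemannZeta_mul_E (k := 6) (by norm_num)
  have hz : riemannZeta (6 : ℕ) ≠ 0 := riemannZeta_ne_zero_of_one_lt_re (by norm_num)
  rw [G_six] at h
  exact (mul_eq_zero.1 h.symm).resolve_left (mul_ne_zero two_ne_zero hz)

end gaussianPeriods

open Real Complex in
lemma etaI_one_eq : (etaI 1 : ℂ) = ModularForm.eta UpperHalfPlane.I := by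
  have hmul : Multipliable fun n : ℕ ↦ 1 - rexp (-2 * π * (n + 1) * 1) := by
    simp_rw [sub_eq_add_neg]
    refine Real.multipliable_one_add_of_summable (Summable.neg ?_)
    have hq : rexp (-2 * π) < 1 := by
      rw [Real.exp_lt_one_iff]; linarith [Real.pi_pos]
    refine ((summable_nat_add_iff 1).2
      (summable_geometric_of_lt_one (Real.exp_pos _).le hq)).congr fun n ↦ ?_
    rw [← Real.exp_nat_mul]
    push_cast
    ring_nf
  have hmap := hmul.map_tprod ofRealHom continuous_ofReal
  simp only [ofRealHom_eq_coe] at hmap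
  rw [etaI, ModularForm.eta, ofReal_mul, hmap]
  congr 1
  · simp only [Function.Periodic.qParam, UpperHalfPlane.coe_I, ofReal_exp]
    congr 1
    push_cast
    linear_combination (-π / 12 : ℂ) * I_sq
  · refine tprod_congr fun n ↦ ?_
    rw [ModularForm.eta_q_eq_cexp, UpperHalfPlane.coe_I]
    push_cast
    congr 2
    linear_combination (-2 * π * (n + 1) : ℂ) * I_sq

lemma etaI_one_pos : 0 < etaI 1 := by
  have h : etaI 1 ≠ 0 := by
    have := ModularForm.eta_ne_zero UpperHalfPlane.I.2
    rw [← etaI_one_eq] at this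
    exact_mod_cast this
  refine lt_of_le_of_ne ?_ h.symm
  refine mul_nonneg (Real.exp_pos _).le (tprod_nonneg fun n ↦ ?_)
  rw [sub_nonneg, Real.exp_le_one_iff]
  have := Real.pi_pos
  have : 0 ≤ π * (n + 1) := by positivity
  linarith

lemma etaI_one_pow :
    (etaI 1 : ℂ) ^ 24 = (45 / π ^ 4 * gaussianPeriods.G 4) ^ 3 / 1728 := by
  have h := ModularForm.discriminant_eq_E₄_cube_sub_E₆_sq UpperHalfPlane.I
  rw [gaussianPeriods.E₄_I, gaussianPeriods.E₆_I] at h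
  rw [etaI_one_eq, ← ModularForm.discriminant, h]
  simp

section RealODE

open Set Filter Topology MeasureTheory

variable {p p' : ℝ → ℝ} {c : ℝ}

/-- A solution of `p'' = 6 p ^ 2 - 2 c ^ 2` on `(0, 1)` blowing up at `0` has no critical point in
the first half of the interval: it would be symmetric about that point. -/
lemma deriv_ne_zero_of_tendsto_atTop
    (hp : ∀ x ∈ Ioo (0 : ℝ) 1, HasDerivAt p (p' x) x)
    (hp' : ∀ x ∈ Ioo (0 : ℝ) 1, HasDerivAt p' (6 * p x ^ 2 - 2 * c ^ 2) x)
    (hlim : Tendsto p (𝓝[>] 0) atTop) {x₀ : ℝ} (hx₀ : x₀ ∈ Ioo (0 : ℝ) (1 / 2)) :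
    p' x₀ ≠ 0 := by
  intro hzero
  obtain ⟨h0, h1⟩ := hx₀
  have hright : ∀ t ∈ Ico 0 x₀, x₀ + t ∈ Ioo (0 : ℝ) 1 := fun t ht ↦
    ⟨by linarith [ht.1], by linarith [ht.2]⟩
  have hleft : ∀ t ∈ Ico 0 x₀, x₀ - t ∈ Ioo (0 : ℝ) 1 := fun t ht ↦
    ⟨by linarith [ht.2], by linarith [ht.1]⟩
  let v : ℝ × ℝ → ℝ × ℝ := fun y ↦ (y.2, 6 * y.1 ^ 2 - 2 * c ^ 2)
  let f : ℝ → ℝ × ℝ := fun t ↦ (p (x₀ + t), p' (x₀ + t))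
  let g : ℝ → ℝ × ℝ := fun t ↦ (p (x₀ - t), -p' (x₀ - t))
  have hf : ∀ t ∈ Ico 0 x₀, HasDerivAt f (v (f t)) t := fun t ht ↦
    ((hp _ (hright t ht)).comp_const_add x₀ t).prodMk
      ((hp' _ (hright t ht)).comp_const_add x₀ t)
  have hg : ∀ t ∈ Ico 0 x₀, HasDerivAt g (v (g t)) t := fun t ht ↦ by
    have := ((hp _ (hleft t ht)).comp_const_sub x₀ t).prodMk
      ((hp' _ (hleft t ht)).comp_const_sub x₀ t).neg
    simpa [v, g] using this
  have hsymm : ∀ t ∈ Ico 0 x₀, p (x₀ + t) = p (x₀ - t) := by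
    intro T hT
    have hsub : Icc 0 T ⊆ Ico 0 x₀ := fun t ht ↦ ⟨ht.1, ht.2.trans_lt hT.2⟩
    have hfc : ContinuousOn f (Icc 0 T) := fun t ht ↦
      (hf t (hsub ht)).continuousAt.continuousWithinAt
    have hgc : ContinuousOn g (Icc 0 T) := fun t ht ↦
      (hg t (hsub ht)).continuousAt.continuousWithinAt
    obtain ⟨R, hR⟩ := ((isCompact_Icc.image_of_continuousOn hfc).union
      (isCompact_Icc.image_of_continuousOn hgc)).isBounded.subset_closedBall 0
    have hv : ContDiff ℝ 1 v := by fun_prop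
    obtain ⟨K, hK⟩ := hv.contDiffOn.exists_lipschitzOnWith one_ne_zero
      (convex_closedBall (0 : ℝ × ℝ) R) (isCompact_closedBall _ _)
    have heq := ODE_solution_unique_of_mem_Icc_right (v := fun _ ↦ v)
      (s := fun _ ↦ Metric.closedBall 0 R) (fun _ _ ↦ hK) hfc
      (fun t ht ↦ (hf t (hsub (Ico_subset_Icc_self ht))).hasDerivWithinAt)
      (fun t ht ↦ hR (.inl ⟨t, Ico_subset_Icc_self ht, rfl⟩)) hgc
      (fun t ht ↦ (hg t (hsub (Ico_subset_Icc_self ht))).hasDerivWithinAt)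
      (fun t ht ↦ hR (.inr ⟨t, Ico_subset_Icc_self ht, rfl⟩))
      (by simp [f, g, hzero])
    exact congrArg Prod.fst (heq ⟨hT.1, le_rfl⟩)
  have hcont : Tendsto (fun x ↦ p (2 * x₀ - x)) (𝓝[>] 0) (𝓝 (p (2 * x₀ - 0))) := by
    have : ContinuousAt p (2 * x₀ - 0) :=
      (hp _ ⟨by linarith, by linarith⟩).continuousAt
    exact (this.comp (f := fun x ↦ 2 * x₀ - x)
      (by fun_prop : ContinuousAt (fun x : ℝ ↦ 2 * x₀ - x) 0)).tendsto.mono_left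
      nhdsWithin_le_nhds
  refine not_tendsto_nhds_of_tendsto_atTop hlim _ (hcont.congr' ?_)
  filter_upwards [Ioo_mem_nhdsGT h0] with x hx
  have := hsymm (x₀ - x) ⟨by linarith [hx.2], by linarith [hx.1]⟩
  rwa [show x₀ + (x₀ - x) = 2 * x₀ - x by ring, sub_sub_cancel] at this

lemma lt_and_deriv_neg_of_sq_eq
    (hp : ∀ x ∈ Ioo (0 : ℝ) 1, HasDerivAt p (p' x) x)
    (hp' : ∀ x ∈ Ioo (0 : ℝ) 1, HasDerivAt p' (6 * p x ^ 2 - 2 * c ^ 2) x)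
    (hsq : ∀ x ∈ Ioo (0 : ℝ) 1, p' x ^ 2 = 4 * p x * (p x ^ 2 - c ^ 2))
    (hlim : Tendsto p (𝓝[>] 0) atTop) {x : ℝ} (hx : x ∈ Ioo (0 : ℝ) (1 / 2)) :
    c < p x ∧ p' x < 0 := by
  have hsub : Ioo (0 : ℝ) (1 / 2) ⊆ Ioo 0 1 := Ioo_subset_Ioo_right (by norm_num)
  have hne : ∀ y ∈ Ioo (0 : ℝ) (1 / 2), p' y ≠ 0 := fun y hy ↦
    deriv_ne_zero_of_tendsto_atTop hp hp' hlim hy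
  have hlarge (M : ℝ) : ∃ y ∈ Ioo 0 x, M < p y := by
    obtain ⟨y, hy, hy'⟩ := ((hlim.eventually_gt_atTop M).and (Ioo_mem_nhdsGT hx.1)).exists
    exact ⟨y, hy', hy⟩
  have hIcc {y : ℝ} (hy : y ∈ Ioo 0 x) : Icc y x ⊆ Ioo 0 (1 / 2) := fun z hz ↦
    ⟨hy.1.trans_le hz.1, hz.2.trans_lt hx.2⟩
  constructor
  · by_contra! hle
    obtain ⟨y, hy, hyc⟩ := hlarge c
    obtain ⟨z, hz, hzc⟩ := intermediate_value_Icc' hy.2.le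
      (fun z hz ↦ (hp z (hsub (hIcc hy hz))).continuousAt.continuousWithinAt) ⟨hle, hyc.le⟩
    refine hne z (hIcc hy hz) ?_
    have := hsq z (hsub (hIcc hy hz))
    rw [hzc] at this
    simpa using this
  · by_contra! hle
    obtain ⟨y, hy, hyx⟩ := hlarge (p x)
    obtain ⟨z, hz, hslope⟩ := exists_hasDerivAt_eq_slope p p' hy.2
      (fun z hz ↦ (hp z (hsub (hIcc hy hz))).continuousAt.continuousWithinAt)
      (fun z hz ↦ hp z (hsub (hIcc hy (Ioo_subset_Icc_self hz))))
    have hz0 : p' z ≤ 0 := by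
      rw [hslope]
      exact div_nonpos_of_nonpos_of_nonneg (by linarith) (by linarith [hy.2])
    obtain ⟨w, hw, hw0⟩ := intermediate_value_Icc hz.2.le
      (fun w hw ↦ (hp' w (hsub
        (hIcc hy ⟨hz.1.le.trans hw.1, hw.2⟩))).continuousAt.continuousWithinAt)
      ⟨hz0, hle⟩
    exact hne w (hIcc hy ⟨hz.1.le.trans hw.1, hw.2⟩) hw0

lemma ofReal_beta_kernel {s : ℝ} (hs : s ∈ Icc (0 : ℝ) 1) :
    (s : ℂ) ^ (((1 / 4 : ℝ) : ℂ) - 1) * (1 - (s : ℂ)) ^ (((1 / 2 : ℝ) : ℂ) - 1) =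
      ((s ^ (-(3 / 4) : ℝ) * (1 - s) ^ (-(1 / 2) : ℝ) : ℝ) : ℂ) := by
  rw [Complex.ofReal_mul, Complex.ofReal_cpow hs.1, Complex.ofReal_cpow (sub_nonneg.2 hs.2)]
  push_cast
  norm_num

lemma intervalIntegrable_beta_kernel :
    IntervalIntegrable (fun s : ℝ ↦ s ^ (-(3 / 4) : ℝ) * (1 - s) ^ (-(1 / 2) : ℝ)) volume 0 1 := by
  have h := (Complex.betaIntegral_convergent (u := (1 / 4 : ℝ)) (v := (1 / 2 : ℝ))
    (by norm_num) (by norm_num)).norm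
  refine h.congr fun s hs ↦ ?_
  rw [uIoc_of_le zero_le_one] at hs
  rw [ofReal_beta_kernel (Ioc_subset_Icc_self hs), Complex.norm_of_nonneg]
  exact mul_nonneg (rpow_nonneg hs.1.le _) (rpow_nonneg (sub_nonneg.2 hs.2) _)

lemma integral_beta_kernel :
    ∫ s in (0 : ℝ)..1, s ^ (-(3 / 4) : ℝ) * (1 - s) ^ (-(1 / 2) : ℝ) =
      Gamma (1 / 4) ^ 2 / √(2 * π) := by
  have hB : ∫ s in (0 : ℝ)..1, s ^ (-(3 / 4) : ℝ) * (1 - s) ^ (-(1 / 2) : ℝ) =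
      Gamma (1 / 4) * Gamma (1 / 2) / Gamma (3 / 4) := by
    have h := Complex.betaIntegral_eq_Gamma_mul_div ((1 / 4 : ℝ) : ℂ) ((1 / 2 : ℝ) : ℂ)
      (by norm_num) (by norm_num)
    rw [Complex.betaIntegral, intervalIntegral.integral_congr fun s hs ↦
      ofReal_beta_kernel (by rwa [uIcc_of_le zero_le_one] at hs),
      intervalIntegral.integral_ofReal, ← Complex.ofReal_add, Complex.Gamma_ofReal,
      Complex.Gamma_ofReal, Complex.Gamma_ofReal, show (1 / 4 + 1 / 2 : ℝ) = 3 / 4 by norm_num] at h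
    exact_mod_cast h
  have hrefl := Real.Gamma_mul_Gamma_one_sub (1 / 4)
  rw [show (1 - 1 / 4 : ℝ) = 3 / 4 by norm_num, show π * (1 / 4) = π / 4 by ring,
    sin_pi_div_four] at hrefl
  have h4 : Gamma (1 / 4) ≠ 0 := (Gamma_pos_of_pos (by norm_num)).ne'
  have h34 : Gamma (3 / 4) ≠ 0 := (Gamma_pos_of_pos (by norm_num)).ne'
  have h2 : √2 ≠ 0 := by positivity
  have hpi : √π ≠ 0 := (sqrt_pos.2 pi_pos).ne'
  rw [hB, Gamma_one_half_eq, sqrt_mul zero_le_two, div_eq_div_iff h34 (by positivity)]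
  rw [eq_div_iff (by positivity)] at hrefl
  have hs2 : √2 ^ 2 = 2 := sq_sqrt zero_le_two
  have hspi : √π ^ 2 = π := sq_sqrt pi_pos.le
  have hrefl' : Gamma (1 / 4) * Gamma (3 / 4) = √2 * √π ^ 2 := by
    rw [hspi]
    apply mul_right_cancel₀ h2
    linear_combination 2 * hrefl - π * hs2
  linear_combination -Gamma (1 / 4) * hrefl'

lemma hasDerivAt_integral_beta_kernel {u : ℝ} (hu : u ∈ Ioo (0 : ℝ) 1) :
    HasDerivAt (fun u ↦ ∫ s in (0 : ℝ)..u, s ^ (-(3 / 4) : ℝ) * (1 - s) ^ (-(1 / 2) : ℝ))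
      (u ^ (-(3 / 4) : ℝ) * (1 - u) ^ (-(1 / 2) : ℝ)) u := by
  have hcont : ∀ s ∈ Ioo (0 : ℝ) 1,
      ContinuousAt (fun s : ℝ ↦ s ^ (-(3 / 4) : ℝ) * (1 - s) ^ (-(1 / 2) : ℝ)) s := fun s hs ↦
    (continuousAt_id.rpow_const (.inl hs.1.ne')).mul
      ((continuousAt_const.sub continuousAt_id).rpow_const (.inl (sub_pos.2 hs.2).ne'))
  refine intervalIntegral.integral_hasDerivAt_right
    (intervalIntegrable_beta_kernel.mono_set ?_)
    (ContinuousAt.stronglyMeasurableAtFilter isOpen_Ioo hcont u hu) (hcont u hu)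
  rw [uIcc_of_le hu.1.le, uIcc_of_le zero_le_one]
  exact Icc_subset_Icc_right hu.2.le

/-- The substitution `y = c ^ 2 / p ^ 2` separates the equation `p' = -2 √(p (p ^ 2 - c ^ 2))`. -/
lemma beta_kernel_mul_deriv {P Q c : ℝ} (hc : 0 < c) (hP : c < P) (hQ : Q < 0)
    (hsq : Q ^ 2 = 4 * P * (P ^ 2 - c ^ 2)) :
    (c ^ 2 / P ^ 2) ^ (-(3 / 4) : ℝ) * (1 - c ^ 2 / P ^ 2) ^ (-(1 / 2) : ℝ) *
      (-(2 * c ^ 2 * Q / P ^ 3)) = 4 * √c := by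
  have hP0 : 0 < P := hc.trans hP
  have hdpos : 0 < P ^ 2 - c ^ 2 := by nlinarith
  obtain ⟨a, ha, rfl⟩ : ∃ a, 0 < a ∧ a ^ 2 = c := ⟨√c, sqrt_pos.2 hc, sq_sqrt hc.le⟩
  obtain ⟨b, hb, rfl⟩ : ∃ b, 0 < b ∧ b ^ 2 = P := ⟨√P, sqrt_pos.2 hP0, sq_sqrt hP0.le⟩
  obtain ⟨d, hd, hd2⟩ : ∃ d, 0 < d ∧ d ^ 2 = (b ^ 2) ^ 2 - (a ^ 2) ^ 2 :=
    ⟨_, sqrt_pos.2 hdpos, sq_sqrt hdpos.le⟩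
  have hQ' : -Q = 2 * b * d := by
    rw [← sq_eq_sq₀ (by linarith) (by positivity)]
    linear_combination hsq - 4 * b ^ 2 * hd2
  have h1 : ((a ^ 2) ^ 2 / (b ^ 2) ^ 2) ^ (-(3 / 4) : ℝ) = ((a / b) ^ 3)⁻¹ := by
    rw [show (a ^ 2) ^ 2 / (b ^ 2) ^ 2 = (a / b) ^ 4 by field_simp, rpow_neg (by positivity),
      ← rpow_natCast_mul (by positivity), ← rpow_natCast]
    norm_num
  have h2 : (1 - (a ^ 2) ^ 2 / (b ^ 2) ^ 2) ^ (-(1 / 2) : ℝ) = b ^ 2 / d := by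
    rw [show 1 - (a ^ 2) ^ 2 / (b ^ 2) ^ 2 = (d / b ^ 2) ^ 2 by field_simp; linarith,
      rpow_neg (by positivity), ← sqrt_eq_rpow, sqrt_sq (by positivity), inv_div]
  rw [h1, h2, sqrt_sq ha.le, show -(2 * (a ^ 2) ^ 2 * Q / (b ^ 2) ^ 3) =
    2 * (a ^ 2) ^ 2 * -Q / (b ^ 2) ^ 3 by ring, hQ']
  field_simp
  ring

/-- The half-period of a solution of `p' ^ 2 = 4 p (p ^ 2 - c ^ 2)`. -/
lemma two_mul_sqrt_eq_of_sq_eq (hc : 0 < c)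
    (hp : ∀ x ∈ Ioo (0 : ℝ) 1, HasDerivAt p (p' x) x)
    (hp' : ∀ x ∈ Ioo (0 : ℝ) 1, HasDerivAt p' (6 * p x ^ 2 - 2 * c ^ 2) x)
    (hsq : ∀ x ∈ Ioo (0 : ℝ) 1, p' x ^ 2 = 4 * p x * (p x ^ 2 - c ^ 2))
    (hlim : Tendsto p (𝓝[>] 0) atTop) (hzero : p 0 = 0) (hhalf : p' (1 / 2) = 0) :
    2 * √c = Gamma (1 / 4) ^ 2 / √(2 * π) := by
  have hsub : Ioo (0 : ℝ) (1 / 2) ⊆ Ioo 0 1 := Ioo_subset_Ioo_right (by norm_num)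
  have hmem : (1 / 2 : ℝ) ∈ Ioo (0 : ℝ) 1 := by norm_num
  have hmain : ∀ x ∈ Ioo (0 : ℝ) (1 / 2), c < p x ∧ p' x < 0 := fun x hx ↦
    lt_and_deriv_neg_of_sq_eq hp hp' hsq hlim hx
  have hpc : ∀ x ∈ Ioo (0 : ℝ) 1, ContinuousAt p x := fun x hx ↦ (hp x hx).continuousAt
  have hp_half : p (1 / 2) = c := by
    have hle : c ≤ p (1 / 2) := by
      refine ge_of_tendsto ((hpc _ hmem).tendsto.mono_left nhdsWithin_le_nhds :
        Tendsto p (𝓝[<] (1 / 2)) _) ?_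
      filter_upwards [Ioo_mem_nhdsLT (by norm_num : (0 : ℝ) < 1 / 2)] with x hx
      exact (hmain x hx).1.le
    have h := hsq _ hmem
    rw [hhalf] at h
    have h' : p (1 / 2) * (p (1 / 2) + c) * (p (1 / 2) - c) = 0 := by linear_combination -h / 4
    have : 0 < p (1 / 2) := by linarith
    exact sub_eq_zero.1 ((mul_eq_zero.1 h').resolve_left (by positivity))
  let y : ℝ → ℝ := fun x ↦ c ^ 2 / p x ^ 2
  have hy0 : y 0 = 0 := by simp [y, hzero]
  have hy1 : y (1 / 2) = 1 := by simp only [y, hp_half]; field_simp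
  have hymem : ∀ x ∈ Ioo (0 : ℝ) (1 / 2), y x ∈ Ioo (0 : ℝ) 1 := fun x hx ↦ by
    have h := (hmain x hx).1
    have : 0 < p x := hc.trans h
    exact ⟨by positivity, (div_lt_one (by positivity)).2 (by gcongr)⟩
  have hymaps : MapsTo y (Icc 0 (1 / 2)) (Icc 0 1) := by
    intro x hx
    rcases hx.1.eq_or_lt with rfl | h0
    · simp [hy0]
    rcases hx.2.eq_or_lt with rfl | h1
    · rw [hy1]; simp
    exact Ioo_subset_Icc_self (hymem x ⟨h0, h1⟩)
  have hycont : ContinuousOn y (Icc 0 (1 / 2)) := by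
    intro x hx
    rcases hx.1.eq_or_lt with rfl | h0
    · refine ContinuousWithinAt.mono (t := Ici 0) ?_ Icc_subset_Ici_self
      rw [← continuousWithinAt_Ioi_iff_Ici, ContinuousWithinAt, hy0]
      exact tendsto_const_nhds.div_atTop ((tendsto_pow_atTop two_ne_zero).comp hlim)
    · have hpos : p x ≠ 0 := by
        rcases hx.2.eq_or_lt with rfl | h1
        · exact hp_half ▸ hc.ne'
        · exact (hc.trans (hmain x ⟨h0, h1⟩).1).ne'
      exact (continuousAt_const.div ((hpc x ⟨h0, by linarith [hx.2]⟩).pow 2)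
        (pow_ne_zero 2 hpos)).continuousWithinAt
  let B : ℝ → ℝ := fun u ↦ ∫ s in (0 : ℝ)..u, s ^ (-(3 / 4) : ℝ) * (1 - s) ^ (-(1 / 2) : ℝ)
  have hBcont : ContinuousOn B (Icc 0 1) := by
    have h := intervalIntegral.continuousOn_primitive_interval
      ((intervalIntegrable_iff' (μ := volume)).1 intervalIntegrable_beta_kernel)
    rwa [uIcc_of_le zero_le_one] at h
  have hderiv : ∀ x ∈ Ioo (0 : ℝ) (1 / 2),
      HasDerivAt (fun x ↦ B (y x) - 4 * √c * x) 0 x := fun x hx ↦ by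
    obtain ⟨h1, h2⟩ := hmain x hx
    have hne : p x ≠ 0 := (hc.trans h1).ne'
    have hy' : HasDerivAt y (-(2 * c ^ 2 * p' x / p x ^ 3)) x := by
      refine ((hasDerivAt_const x (c ^ 2)).div ((hp x (hsub hx)).pow 2)
        (pow_ne_zero 2 hne)).congr_deriv ?_
      simp only [Pi.pow_apply]
      field_simp
      norm_num
      ring
    have h := (((hasDerivAt_integral_beta_kernel (hymem x hx)).comp x hy').sub
      ((hasDerivAt_id x).const_mul (4 * √c)))
    rwa [beta_kernel_mul_deriv hc h1 h2 (hsq x (hsub hx)), mul_one, sub_self] at h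
  obtain ⟨z, -, hz⟩ := exists_hasDerivAt_eq_slope (fun x ↦ B (y x) - 4 * √c * x) (fun _ ↦ 0)
    (by norm_num : (0 : ℝ) < 1 / 2)
    ((hBcont.comp hycont hymaps).sub (by fun_prop)) hderiv
  have hB0 : B 0 = 0 := intervalIntegral.integral_same
  have hB1 : B 1 = Gamma (1 / 4) ^ 2 / √(2 * π) := integral_beta_kernel
  simp only [hy0, hy1, hB0, hB1] at hz
  linarith [(div_eq_zero_iff.1 hz.symm).resolve_right (by norm_num)]

end RealODE

namespace PeriodPair

open Set Filter Topology

variable (L : PeriodPair)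

lemma hasDerivAt_weierstrassP {z : ℂ} (hz : z ∉ L.lattice) :
    HasDerivAt L.weierstrassP (L.derivWeierstrassP z) z := by
  rw [← L.deriv_weierstrassP]
  exact (L.analyticOnNhd_weierstrassP z hz).differentiableAt.hasDerivAt

lemma isPreconnected_compl_lattice : IsPreconnected (L.lattice : Set ℂ)ᶜ := by
  have hcount : (L.lattice : Set ℂ).Countable := L.latticeEquivProd.toEquiv.countable_iff.2
    inferInstance
  exact (hcount.isPathConnected_compl_of_one_lt_rank (by simp)).isConnected.isPreconnected

lemma exists_derivWeierstrassP_ne_zero : ∃ z ∉ L.lattice, L.derivWeierstrassP z ≠ 0 := by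
  by_contra! h
  obtain ⟨a, ha⟩ := L.isClosed_lattice.isOpen_compl.exists_is_const_of_deriv_eq_zero
    L.isPreconnected_compl_lattice L.differentiableOn_weierstrassP
    (fun z hz ↦ by rw [deriv_weierstrassP]; exact h z hz)
  have hev : L.weierstrassP =ᶠ[𝓝[≠] 0] fun _ ↦ a := by
    filter_upwards [nhdsWithin_le_nhds (L.compl_lattice_sdiff_singleton_mem_nhds 0),
      self_mem_nhdsWithin] with z hz hz0
    exact ha z fun hmem ↦ hz ⟨hmem, hz0⟩
  have hle := (analyticAt_const (𝕜 := ℂ) (v := a) (x := (0 : ℂ))).meromorphicOrderAt_nonneg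
  rw [← meromorphicOrderAt_congr hev, L.order_weierstrassP 0 L.lattice.zero_mem] at hle
  exact absurd hle (by decide)

/-- `℘'' = 6 ℘² - g₂ / 2` -/
lemma hasDerivAt_derivWeierstrassP {z : ℂ} (hz : z ∉ L.lattice) :
    HasDerivAt L.derivWeierstrassP (6 * L.weierstrassP z ^ 2 - L.g₂ / 2) z := by
  have hopen := L.isClosed_lattice.isOpen_compl
  have hmul : ∀ w ∈ (L.lattice : Set ℂ)ᶜ, L.derivWeierstrassP w *
      (deriv L.derivWeierstrassP w - (6 * L.weierstrassP w ^ 2 - L.g₂ / 2)) = 0 := by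
    intro w hw
    have h1 := (L.analyticOnNhd_derivWeierstrassP w hw).differentiableAt.hasDerivAt.pow 2
    have h2 := ((((L.hasDerivAt_weierstrassP hw).pow 3).const_mul 4).sub
      ((L.hasDerivAt_weierstrassP hw).const_mul L.g₂)).sub_const L.g₃
    have h3 := (h1.congr_of_eventuallyEq (f₁ := fun z ↦ 4 * L.weierstrassP z ^ 3 -
      L.g₂ * L.weierstrassP z - L.g₃) (by
        filter_upwards [hopen.mem_nhds hw] with z hz
        exact (L.derivWeierstrassP_sq z hz).symm)).unique h2
    norm_num at h3
    linear_combination h3 / 2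
  have hzero := (AnalyticOnNhd.eq_zero_or_eq_zero_of_mul_eq_zero L.analyticOnNhd_derivWeierstrassP
    (L.analyticOnNhd_derivWeierstrassP.deriv.sub
      ((analyticOnNhd_const.mul (L.analyticOnNhd_weierstrassP.pow 2)).sub analyticOnNhd_const))
    hmul L.isPreconnected_compl_lattice).resolve_left fun h ↦ by
      obtain ⟨w, hw, hw0⟩ := L.exists_derivWeierstrassP_ne_zero
      exact hw0 (h w hw)
  have h := (L.analyticOnNhd_derivWeierstrassP z hz).differentiableAt.hasDerivAt
  exact h.congr_deriv (sub_eq_zero.1 (hzero z hz))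

end PeriodPair

namespace gaussianPeriods

open Set Filter Topology

lemma ofReal_notMem_lattice {x : ℝ} (hx : x ∈ Ioo (0 : ℝ) 1) :
    (x : ℂ) ∉ gaussianPeriods.lattice := by
  intro h
  obtain ⟨m, n, hmn⟩ := mem_lattice_iff.1 h
  have hre : (m : ℝ) = x := by simpa using congrArg Complex.re hmn
  have h0 : (0 : ℝ) < m := hre ▸ hx.1
  have h1 : (m : ℝ) < 1 := hre ▸ hx.2
  norm_cast at h0 h1
  omega

lemma ofReal_re_weierstrassP (x : ℝ) :
    ((gaussianPeriods.weierstrassP x).re : ℂ) = gaussianPeriods.weierstrassP x :=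
  Complex.conj_eq_iff_re.1 (by rw [conj_weierstrassP, Complex.conj_ofReal])

lemma ofReal_re_derivWeierstrassP (x : ℝ) :
    ((gaussianPeriods.derivWeierstrassP x).re : ℂ) = gaussianPeriods.derivWeierstrassP x :=
  Complex.conj_eq_iff_re.1 (by rw [conj_derivWeierstrassP, Complex.conj_ofReal])

lemma ofReal_re_G (k : ℕ) : ((gaussianPeriods.G k).re : ℂ) = gaussianPeriods.G k :=
  Complex.conj_eq_iff_re.1 (conj_G k)

lemma derivWeierstrassP_half : gaussianPeriods.derivWeierstrassP (1 / 2 : ℝ) = 0 := by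
  have h := gaussianPeriods.derivWeierstrassP_add_coe (-(1 / 2 : ℝ) : ℂ)
    ⟨1, mem_lattice_iff.2 ⟨1, 0, by simp⟩⟩
  rw [gaussianPeriods.derivWeierstrassP_neg] at h
  norm_num at h ⊢
  exact CharZero.eq_neg_self_iff.1 h

lemma tendsto_re_weierstrassP :
    Tendsto (fun x : ℝ ↦ (gaussianPeriods.weierstrassP x).re) (𝓝[>] 0) atTop := by
  have hcont : Tendsto (fun x : ℝ ↦ (gaussianPeriods.weierstrassPExcept 0 x).re) (𝓝[>] 0)
      (𝓝 (gaussianPeriods.weierstrassPExcept 0 (0 : ℝ)).re) := by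
    have h : ContinuousAt (gaussianPeriods.weierstrassPExcept 0) ((0 : ℝ) : ℂ) :=
      (gaussianPeriods.analyticAt_weierstrassPExcept 0).continuousAt
    exact (Complex.continuous_re.continuousAt.comp
      (h.comp Complex.continuous_ofReal.continuousAt)).tendsto.mono_left nhdsWithin_le_nhds
  have hinv : Tendsto (fun x : ℝ ↦ (x⁻¹) ^ 2) (𝓝[>] 0) atTop :=
    (tendsto_pow_atTop two_ne_zero).comp tendsto_inv_nhdsGT_zero
  refine (hcont.add_atTop hinv).congr' ?_
  filter_upwards [self_mem_nhdsWithin] with x hx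
  have hx0 : (x : ℂ) ≠ 0 := Complex.ofReal_ne_zero.2 (ne_of_gt hx)
  have h := gaussianPeriods.ite_eq_one_sub_sq_mul_weierstrassP 0
    gaussianPeriods.lattice.zero_mem x
  rw [if_neg hx0] at h
  have h' : gaussianPeriods.weierstrassP x =
      gaussianPeriods.weierstrassPExcept 0 x + ((x⁻¹ ^ 2 : ℝ) : ℂ) := by
    apply mul_left_cancel₀ (pow_ne_zero 2 hx0)
    push_cast
    field_simp
    simpa using h
  rw [h', Complex.add_re, Complex.ofReal_re]

lemma re_G_four_pos : 0 < (gaussianPeriods.G 4).re := by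
  have h := etaI_one_pow
  rw [← ofReal_re_G] at h
  have h' : etaI 1 ^ 24 = (45 / π ^ 4 * (gaussianPeriods.G 4).re) ^ 3 / 1728 := by
    exact_mod_cast h
  have hpos : 0 < (45 / π ^ 4 * (gaussianPeriods.G 4).re) ^ 3 := by
    have := pow_pos etaI_one_pos 24
    linarith
  have := (Odd.pow_pos_iff (by decide : Odd 3)).1 hpos
  exact pos_of_mul_pos_right this (by positivity)

lemma two_mul_sqrt_eq {c : ℝ} (hc : 0 < c) (hG : 15 * (gaussianPeriods.G 4).re = c ^ 2) :
    2 * √c = Gamma (1 / 4) ^ 2 / √(2 * π) := by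
  have hg₂ : gaussianPeriods.g₂ = 4 * (c : ℂ) ^ 2 := by
    rw [PeriodPair.g₂, ← ofReal_re_G, ← Complex.ofReal_pow, ← hG]
    push_cast
    ring
  have hg₃ : gaussianPeriods.g₃ = 0 := by rw [PeriodPair.g₃, G_six, mul_zero]
  refine two_mul_sqrt_eq_of_sq_eq hc
    (p := fun x ↦ (gaussianPeriods.weierstrassP x).re)
    (p' := fun x ↦ (gaussianPeriods.derivWeierstrassP x).re)
    (fun x hx ↦ (gaussianPeriods.hasDerivAt_weierstrassP
      (ofReal_notMem_lattice hx)).real_of_complex) (fun x hx ↦ ?_) (fun x hx ↦ ?_)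
    tendsto_re_weierstrassP (by simp) (by rw [derivWeierstrassP_half, Complex.zero_re])
  · have h := (gaussianPeriods.hasDerivAt_derivWeierstrassP
      (ofReal_notMem_lattice hx)).real_of_complex
    rw [hg₂, ← ofReal_re_weierstrassP] at h
    refine h.congr_deriv ?_
    norm_cast
    ring
  · have h := gaussianPeriods.derivWeierstrassP_sq x (ofReal_notMem_lattice hx)
    rw [hg₂, hg₃, ← ofReal_re_weierstrassP, ← ofReal_re_derivWeierstrassP, sub_zero] at h
    norm_cast at h
    linear_combination h

lemma G_four : gaussianPeriods.G 4 = ((Gamma (1 / 4) ^ 8 / (960 * π ^ 2) : ℝ) : ℂ) := by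
  have hpos : 0 < 15 * (gaussianPeriods.G 4).re := by linarith [re_G_four_pos]
  have hc := sqrt_pos.2 hpos
  have h := two_mul_sqrt_eq hc (sq_sqrt hpos.le).symm
  have h4 := congrArg (· ^ 4) h
  have hsq : √(2 * π) ^ 4 = (2 * π) ^ 2 := by
    rw [show 4 = 2 * 2 from rfl, pow_mul, sq_sqrt (by positivity)]
  have hsq' : √√(15 * (gaussianPeriods.G 4).re) ^ 4 = 15 * (gaussianPeriods.G 4).re := by
    rw [show 4 = 2 * 2 from rfl, pow_mul, sq_sqrt hc.le, sq_sqrt hpos.le]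
  simp only [mul_pow, div_pow, hsq, hsq'] at h4
  rw [← ofReal_re_G]
  congr 1
  field_simp at h4 ⊢
  linarith

end gaussianPeriods

/-- The special value `η(i) = Γ(1/4)/(2π^{3/4})`, equivalently
`1/η(i)² = 4π^{3/2}/Γ(1/4)²`. -/
theorem dedekind_eta_at_i :
    etaI 1 = Real.Gamma (1 / 4) / (2 * π ^ ((3 : ℝ) / 4)) ∧
    1 / (etaI 1) ^ 2 = 4 * π ^ ((3 : ℝ) / 2) / (Real.Gamma (1 / 4)) ^ 2 := by
  have hΓ : 0 < Gamma (1 / 4) := Gamma_pos_of_pos (by norm_num)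
  have hpi : 0 < π ^ ((3 : ℝ) / 4) := rpow_pos_of_pos pi_pos _
  have hη : etaI 1 = Gamma (1 / 4) / (2 * π ^ ((3 : ℝ) / 4)) := by
    have h := etaI_one_pow
    rw [gaussianPeriods.G_four] at h
    norm_cast at h
    rw [← pow_left_inj₀ etaI_one_pos.le (by positivity) (by norm_num : 24 ≠ 0), div_pow, mul_pow,
      ← rpow_mul_natCast pi_pos.le, show (3 : ℝ) / 4 * (24 : ℕ) = (18 : ℕ) by norm_num,
      rpow_natCast]
    rw [h]
    field_simp
    norm_num
  refine ⟨hη, ?_⟩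
  rw [hη, show π ^ ((3 : ℝ) / 2) = (π ^ ((3 : ℝ) / 4)) ^ 2 by
    rw [← rpow_mul_natCast pi_pos.le]; norm_num]
  field_simp
  norm_num
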